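/- arXiv:math/0412169 — 7 statements merged into one kernel-verified Lean document; each statement's English description precedes it below -/
import Mathlib

section
/- Let L be a Lie ring (or a Lie algebra over a commutative ring in which 2 is invertible) and let X, A1, A2 ∈ L with [A1, A2] = 0. Then [A1 − [X,A1], A2 − [X,A2]] = (1/2)·([[[X,A1],X],A2] − [[[X,A2],X],A1]). -/
/-- If `⁅A, B⁆ = 0`, the terms of `⁅A - ⁅X, A⁆, B - ⁅X, B⁆⁆` linear in `X` cancel. -/
theorem lie_sub_lie_of_lie_eq_zero {L : Type*} [LieRing L] (X A B : L) (h : ⁅A, B⁆ = 0) :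
    ⁅A - ⁅X, A⁆, B - ⁅X, B⁆⁆ = ⁅⁅X, A⁆, ⁅X, B⁆⁆ := by
  have hX : ⁅⁅X, A⁆, B⁆ + ⁅A, ⁅X, B⁆⁆ = 0 := by rw [← leibniz_lie, h, lie_zero]
  rw [sub_lie, lie_sub, lie_sub, h, eq_neg_of_add_eq_zero_left hX]
  abel

/-- The division-free form of the identity, valid in every Lie ring: it is `(ad X)²` applied to
`⁅A, B⁆ = 0`. -/
theorem two_nsmul_lie_sub_lie_of_lie_eq_zero {L : Type*} [LieRing L] (X A B : L)
    (h : ⁅A, B⁆ = 0) :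
    2 • ⁅A - ⁅X, A⁆, B - ⁅X, B⁆⁆ = ⁅⁅⁅X, A⁆, X⁆, B⁆ - ⁅⁅⁅X, B⁆, X⁆, A⁆ := by
  have hXX : ⁅⁅X, ⁅X, A⁆⁆, B⁆ + ⁅⁅X, A⁆, ⁅X, B⁆⁆ + (⁅⁅X, A⁆, ⁅X, B⁆⁆ + ⁅A, ⁅X, ⁅X, B⁆⁆⁆) = 0 := by
    rw [← leibniz_lie, ← leibniz_lie, ← lie_add, ← leibniz_lie, h, lie_zero, lie_zero]
  rw [lie_sub_lie_of_lie_eq_zero X A B h, ← lie_skew ⁅X, A⁆ X, ← lie_skew ⁅X, B⁆ X, neg_lie,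
    neg_lie, ← sub_eq_zero, ← hXX, ← lie_skew A]
  abel

/-- In any Lie algebra over `ℝ` (a Lie ring where division by 2 makes sense),
if `⁅A1, A2⁆ = 0` then
`⁅A1 − ⁅X,A1⁆, A2 − ⁅X,A2⁆⁆ = (1/2)·(⁅⁅⁅X,A1⁆,X⁆,A2⁆ − ⁅⁅⁅X,A2⁆,X⁆,A1⁆)`. -/
theorem lie_sub_lie_eq_half_smul_of_lie_eq_zero
    (L : Type*) [LieRing L] [LieAlgebra ℝ L] (X A1 A2 : L) (h : ⁅A1, A2⁆ = 0) :
    ⁅A1 - ⁅X, A1⁆, A2 - ⁅X, A2⁆⁆ =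
      (1 / 2 : ℝ) • (⁅⁅⁅X, A1⁆, X⁆, A2⁆ - ⁅⁅⁅X, A2⁆, X⁆, A1⁆) := by
  rw [one_div, eq_inv_smul_iff₀ two_ne_zero, ofNat_smul_eq_nsmul]
  exact two_nsmul_lie_sub_lie_of_lie_eq_zero X A1 A2 h
end

section
/- For every X ∈ g1 and all A1, A2 ∈ a, the element [A1 − [X, A1], A2 − [X, A2]] lies in b. In particular, for the tableau element Q = −ad_X restricted to a, the curvature R_Q (the class of [A1 + Q(A1), A2 + Q(A2)] in g/(a ⊕ b)) vanishes identically. (This is part (1) of the Proposition asserting that the Cartan tableau m ⊆ Hom(a, b) is a tableau over g.) -/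
open LieAlgebra

/-- The adjoint actions of commuting elements commute. -/
theorem lie_lie_comm_of_lie_eq_zero {L : Type*} [LieRing L] {x y : L} (h : ⁅x, y⁆ = 0) (z : L) :
    ⁅x, ⁅y, z⁆⁆ = ⁅y, ⁅x, z⁆⁆ := by
  rw [leibniz_lie, h, zero_lie, zero_add]

/-- The adjoint action is skew-adjoint for the Killing form. -/
theorem killingForm_lie_right {L : Type*} [LieRing L] [LieAlgebra ℝ L] (x y z : L) :
    killingForm ℝ L x ⁅y, z⁆ = -killingForm ℝ L ⁅y, x⁆ z := by
  rw [← LieModule.traceForm_apply_lie_apply, ← lie_skew, map_neg, LinearMap.neg_apply]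

/-- A product of three commuting adjoint operators is skew-adjoint for the Killing form, so its
quadratic form vanishes. -/
theorem killingForm_lie_lie_lie_self {L : Type*} [LieRing L] [LieAlgebra ℝ L] {x y z : L}
    (hxy : ⁅x, y⁆ = 0) (hzx : ⁅z, x⁆ = 0) (hzy : ⁅z, y⁆ = 0) (w : L) :
    killingForm ℝ L w ⁅x, ⁅y, ⁅z, w⁆⁆⁆ = 0 := by
  have h : killingForm ℝ L w ⁅x, ⁅y, ⁅z, w⁆⁆⁆ = -killingForm ℝ L w ⁅x, ⁅y, ⁅z, w⁆⁆⁆ := by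
    conv_lhs => rw [killingForm_lie_right, killingForm_lie_right, killingForm_lie_right,
      lie_lie_comm_of_lie_eq_zero hzy, lie_lie_comm_of_lie_eq_zero hzx,
      ← lie_lie_comm_of_lie_eq_zero hxy, LieModule.traceForm_comm]
    rw [neg_neg]
  linarith

/-- Context: `g` is a finite-dimensional real Lie algebra with Killing form `κ`,
`g0` a subalgebra and `g1` a complementary subspace with `[g0,g1] ⊆ g1`,
`[g1,g1] ⊆ g0`, and `a ⊆ g1` an abelian subspace.  With
`(g0)_a = {Y ∈ g0 : [Y, a] = 0}` and `b = {Z ∈ g0 : κ(Z, (g0)_a) = 0}`,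
for every `X ∈ g1` and all `A1, A2 ∈ a`, the element
`⁅A1 − ⁅X,A1⁆, A2 − ⁅X,A2⁆⁆` lies in `b`
(that is, it belongs to `g0` and is `κ`-orthogonal to `(g0)_a`).
In particular, for the tableau element `Q = −ad_X` restricted to `a`, the
curvature `R_Q` (the class of `⁅A1 + Q(A1), A2 + Q(A2)⁆` in `g/(a ⊕ b)`)
vanishes identically: part (1) of the Proposition that the Cartan tableau
`m ⊆ Hom(a, b)` is a tableau over `g`. -/
theorem lie_sub_lie_mem_b
    (g : Type*) [LieRing g] [LieAlgebra ℝ g] [FiniteDimensional ℝ g]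
    (g0 : LieSubalgebra ℝ g) (g1 : Submodule ℝ g)
    (hds : IsCompl g0.toSubmodule g1)
    (h01 : ∀ Y ∈ g0, ∀ X ∈ g1, ⁅Y, X⁆ ∈ g1)
    (h11 : ∀ X ∈ g1, ∀ X' ∈ g1, ⁅X, X'⁆ ∈ g0)
    (a : Submodule ℝ g) (ha : a ≤ g1)
    (habel : ∀ A ∈ a, ∀ A' ∈ a, ⁅A, A'⁆ = 0)
    (X : g) (hX : X ∈ g1) (A1 : g) (hA1 : A1 ∈ a) (A2 : g) (hA2 : A2 ∈ a) :
    ⁅A1 - ⁅X, A1⁆, A2 - ⁅X, A2⁆⁆ ∈ g0 ∧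
      ∀ Y ∈ g0, (∀ A' ∈ a, ⁅Y, A'⁆ = 0) →
        killingForm ℝ g ⁅A1 - ⁅X, A1⁆, A2 - ⁅X, A2⁆⁆ Y = 0 := by
  have h : ⁅A1 - ⁅X, A1⁆, A2 - ⁅X, A2⁆⁆ = ⁅⁅X, A1⁆, ⁅X, A2⁆⁆ := by
    have hX12 := leibniz_lie X A1 A2
    rw [habel A1 hA1 A2 hA2, lie_zero] at hX12
    rw [sub_lie, lie_sub, lie_sub, habel A1 hA1 A2 hA2, eq_neg_of_add_eq_zero_left hX12.symm]
    abel
  rw [h]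
  refine ⟨g0.lie_mem (h11 X hX A1 (ha hA1)) (h11 X hX A2 (ha hA2)), fun Y _ hYa => ?_⟩
  have hY : ⁅⁅X, A2⁆, Y⁆ = ⁅A2, ⁅Y, X⁆⁆ := by
    rw [← lie_lie_comm_of_lie_eq_zero (hYa A2 hA2), ← lie_skew, ← lie_skew A2 X, lie_neg]
  rw [LieModule.traceForm_apply_lie_apply, hY, LieModule.traceForm_apply_lie_apply]
  exact killingForm_lie_lie_lie_self (habel A1 hA1 A2 hA2) (hYa A1 hA1) (hYa A2 hA2) X
end

section
/- Let g be a finite-dimensional real Lie algebra, k ≥ 1, and let A_1, …, A_k ∈ g be pairwise commuting elements. Let V : ℝ^k → g be a differentiable map, and for each i set θ_i(x) = A_i + [A_i, V(x)]. Then the zero-curvature (Maurer–Cartan) equations ∂_i θ_j − ∂_j θ_i + [θ_i, θ_j] = 0 hold for all i, j and all x ∈ ℝ^k if and only if V satisfies the G/G_0-system: [A_i, ∂_j V(x)] − [A_j, ∂_i V(x)] = [[A_i, V(x)], [A_j, V(x)]] for all i ≠ j and all x ∈ ℝ^k. -/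
/-- The derivative of `x ↦ a + L (V x)` for a linear map `L` on a finite-dimensional space. -/
theorem fderiv_const_add_linearMap_comp
    {E g : Type*} [NormedAddCommGroup E] [NormedSpace ℝ E]
    [NormedAddCommGroup g] [NormedSpace ℝ g] [FiniteDimensional ℝ g]
    (L : g →ₗ[ℝ] g) (a : g) {V : E → g} {x : E} (hV : DifferentiableAt ℝ V x) (v : E) :
    fderiv ℝ (fun y => a + L (V y)) x v = L (fderiv ℝ V x v) := by
  have h : HasFDerivAt (fun y => a + L (V y))
      ((LinearMap.toContinuousLinearMap L).comp (fderiv ℝ V x)) x :=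
    ((LinearMap.toContinuousLinearMap L).hasFDerivAt.comp x hV.hasFDerivAt).const_add a
  rw [h.fderiv]
  rfl

/-- For commuting `a` and `b`, the terms of `⁅a + ⁅a, v⁆, b + ⁅b, v⁆⁆` linear in `v` cancel. -/
theorem lie_add_lie_of_commute {g : Type*} [AddCommGroup g] [Module ℝ g]
    (lie : g →ₗ[ℝ] g →ₗ[ℝ] g) (halt : ∀ x, lie x x = 0)
    (hjacobi : ∀ x y z, lie x (lie y z) = lie (lie x y) z + lie y (lie x z))
    {a b : g} (hab : lie a b = 0) (v : g) :
    lie (a + lie a v) (b + lie b v) = lie (lie a v) (lie b v) := by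
  have hskew : lie (lie a v) b = -lie b (lie a v) :=
    (LinearMap.IsAlt.neg halt b (lie a v)).symm
  have hswap : lie a (lie b v) = lie b (lie a v) := by
    simpa [hab] using hjacobi a b v
  simp only [map_add, LinearMap.add_apply, hab, hskew, hswap]
  abel

/-- Let `g` be a finite-dimensional real Lie algebra (a finite-dimensional real
normed space with a bilinear bracket `lie` satisfying `lie x x = 0` and the
Jacobi identity), `k ≥ 1`, and `A 1, …, A k` pairwise commuting elements of
`g`.  Let `V : ℝᵏ → g` be differentiable and set
`θ i x = A i + ⁅A i, V x⁆`.  Then the zero-curvature (Maurer–Cartan)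
equations `∂ᵢ θⱼ − ∂ⱼ θᵢ + ⁅θᵢ, θⱼ⁆ = 0` hold for all `i, j, x` if and only
if `V` satisfies the `G/G₀`-system of Terng:
`⁅A i, ∂ⱼ V⁆ − ⁅A j, ∂ᵢ V⁆ = ⁅⁅A i, V⁆, ⁅A j, V⁆⁆` for all `i ≠ j` and `x`. -/
theorem zero_curvature_iff_GG0_system
    {g : Type*} [NormedAddCommGroup g] [NormedSpace ℝ g] [FiniteDimensional ℝ g]
    (lie : g →ₗ[ℝ] g →ₗ[ℝ] g)
    (halt : ∀ x, lie x x = 0)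
    (hjacobi : ∀ x y z, lie x (lie y z) = lie (lie x y) z + lie y (lie x z))
    (k : ℕ) (hk : 1 ≤ k)
    (A : Fin k → g) (hcomm : ∀ i j, lie (A i) (A j) = 0)
    (V : (Fin k → ℝ) → g) (hV : Differentiable ℝ V)
    (θ : Fin k → (Fin k → ℝ) → g)
    (hθ : ∀ i x, θ i x = A i + lie (A i) (V x)) :
    (∀ i j x, fderiv ℝ (θ j) x (Pi.single i 1) - fderiv ℝ (θ i) x (Pi.single j 1)
        + lie (θ i x) (θ j x) = 0) ↔
      (∀ i j x, i ≠ j →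
        lie (A i) (fderiv ℝ V x (Pi.single j 1))
            - lie (A j) (fderiv ℝ V x (Pi.single i 1))
          = lie (lie (A i) (V x)) (lie (A j) (V x))) := by
  have hcurv : ∀ i j x,
      fderiv ℝ (θ j) x (Pi.single i 1) - fderiv ℝ (θ i) x (Pi.single j 1)
          + lie (θ i x) (θ j x) =
        lie (lie (A i) (V x)) (lie (A j) (V x))
          - (lie (A i) (fderiv ℝ V x (Pi.single j 1))
            - lie (A j) (fderiv ℝ V x (Pi.single i 1))) := by
    intro i j x
    rw [funext (hθ i), funext (hθ j), fderiv_const_add_linearMap_comp _ _ (hV x),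
      fderiv_const_add_linearMap_comp _ _ (hV x),
      lie_add_lie_of_commute lie halt hjacobi (hcomm i j)]
    abel
  simp only [hcurv, sub_eq_zero]
  refine ⟨fun h i j x _ => (h i j x).symm, fun h i j x => ?_⟩
  rcases eq_or_ne i j with rfl | hij
  · rw [halt, sub_self]
  · exact (h i j x hij).symm
end

section
/- The first prolongation W^(1) of the Fubini–Cartan tableau W has dimension 7. -/
set_option synthInstance.maxHeartbeats 1000000
set_option maxHeartbeats 1000000

open Module

noncomputable instance innerHomAddCommGroup :
    AddCommGroup ((Fin 2 → ℝ) →ₗ[ℝ] (Fin 5 → ℝ)) :=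
  @LinearMap.addCommGroup ℝ ℝ (Fin 2 → ℝ) (Fin 5 → ℝ) _ _ _ _ _ _ (RingHom.id ℝ)

noncomputable instance outerHomAddCommGroup :
    AddCommGroup ((Fin 2 → ℝ) →ₗ[ℝ] ((Fin 2 → ℝ) →ₗ[ℝ] (Fin 5 → ℝ))) :=
  @LinearMap.addCommGroup ℝ ℝ (Fin 2 → ℝ) ((Fin 2 → ℝ) →ₗ[ℝ] (Fin 5 → ℝ))
    _ _ _ _ _ _ (RingHom.id ℝ)

noncomputable instance outerHomSubAddCommGroup
    (P : Submodule ℝ ((Fin 2 → ℝ) →ₗ[ℝ] ((Fin 2 → ℝ) →ₗ[ℝ] (Fin 5 → ℝ)))) :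
    AddCommGroup ↥P := by exact @Submodule.addCommGroup ℝ _ _ _ _ P

/-- The first standard basis vector `e1` of `a = ℝ²`. -/
noncomputable def e1 : Fin 2 → ℝ := Pi.single 0 1
/-- The second standard basis vector `e2` of `a = ℝ²`. -/
noncomputable def e2 : Fin 2 → ℝ := Pi.single 1 1

/-- `memW Q q1 q2 p1 p2 r1 r2` says that `Q ∈ Hom(ℝ², ℝ⁵)` is the element
`Q(q1,q2,p1,p2,r1,r2)` of the Fubini–Cartan tableau, i.e.
`Q(e1) = (−(3/2)q1, (1/2)q1, r1, p1, r2)` and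
`Q(e2) = ((3/2)q2, (1/2)q2, p2, r2, r1)`. -/
def memW (Q : (Fin 2 → ℝ) →ₗ[ℝ] (Fin 5 → ℝ))
    (q1 q2 p1 p2 r1 r2 : ℝ) : Prop :=
  Q e1 = ![-(3/2) * q1, (1/2) * q1, r1, p1, r2] ∧
  Q e2 = ![(3/2) * q2, (1/2) * q2, p2, r2, r1]

/-- The Fubini–Cartan tableau `W ⊆ Hom(ℝ², ℝ⁵)`, the 6-dimensional subspace
of all `Q(q1,q2,p1,p2,r1,r2)` for `(q1,q2,p1,p2,r1,r2) ∈ ℝ⁶`. -/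
noncomputable def W : Submodule ℝ ((Fin 2 → ℝ) →ₗ[ℝ] (Fin 5 → ℝ)) where
  carrier := {Q | ∃ q1 q2 p1 p2 r1 r2 : ℝ, memW Q q1 q2 p1 p2 r1 r2}
  add_mem' := by
    rintro Q Q' ⟨a1, a2, a3, a4, a5, a6, h1, h2⟩ ⟨b1, b2, b3, b4, b5, b6, k1, k2⟩
    refine ⟨a1 + b1, a2 + b2, a3 + b3, a4 + b4, a5 + b5, a6 + b6, ?_, ?_⟩ <;>
      · simp only [LinearMap.add_apply, h1, h2, k1, k2]
        funext i; fin_cases i <;> simp <;> ring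
  zero_mem' := by
    refine ⟨0, 0, 0, 0, 0, 0, ?_, ?_⟩ <;>
      · funext i; fin_cases i <;> simp
  smul_mem' := by
    rintro c Q ⟨a1, a2, a3, a4, a5, a6, h1, h2⟩
    refine ⟨c * a1, c * a2, c * a3, c * a4, c * a5, c * a6, ?_, ?_⟩ <;>
      · simp only [LinearMap.smul_apply, h1, h2]
        funext i; fin_cases i <;> simp <;> ring

/-- The first prolongation `T⁽¹⁾ = {F ∈ Hom(ℝ², T) : F(e1)(e2) = F(e2)(e1)}`
of a linear subspace `T ⊆ Hom(ℝ², ℝ⁵)`, where `Hom(ℝ², T)` is realized as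
the space of linear maps `ℝ² → Hom(ℝ², ℝ⁵)` all of whose values lie in `T`. -/
noncomputable def prolong (T : Submodule ℝ ((Fin 2 → ℝ) →ₗ[ℝ] (Fin 5 → ℝ))) :
    Submodule ℝ ((Fin 2 → ℝ) →ₗ[ℝ] ((Fin 2 → ℝ) →ₗ[ℝ] (Fin 5 → ℝ))) where
  carrier := {F | (∀ v, F v ∈ T) ∧ F e1 e2 = F e2 e1}
  add_mem' := by
    rintro F G ⟨hF1, hF2⟩ ⟨hG1, hG2⟩
    exact ⟨fun v => T.add_mem (hF1 v) (hG1 v), by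
      simp [LinearMap.add_apply, hF2, hG2]⟩
  zero_mem' := ⟨fun v => T.zero_mem, by simp⟩
  smul_mem' := by
    rintro c F ⟨hF1, hF2⟩
    exact ⟨fun v => T.smul_mem c (hF1 v), by
      simp [LinearMap.smul_apply, hF2]⟩

/-- The subspace `{Q ∈ T : Q(v) = 0}` of a linear subspace
`T ⊆ Hom(ℝ², ℝ⁵)`: the elements of `T` vanishing on (the line spanned by)
`v`, i.e. on the first subspace of the flag determined by `v`. -/
noncomputable def vanishAt (T : Submodule ℝ ((Fin 2 → ℝ) →ₗ[ℝ] (Fin 5 → ℝ)))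
    (v : Fin 2 → ℝ) : Submodule ℝ ((Fin 2 → ℝ) →ₗ[ℝ] (Fin 5 → ℝ)) where
  carrier := {Q | Q ∈ T ∧ Q v = 0}
  add_mem' := by
    rintro Q Q' ⟨hQ1, hQ2⟩ ⟨hQ'1, hQ'2⟩
    exact ⟨T.add_mem hQ1 hQ'1, by simp [LinearMap.add_apply, hQ2, hQ'2]⟩
  zero_mem' := ⟨T.zero_mem, by simp⟩
  smul_mem' := by
    rintro c Q ⟨hQ1, hQ2⟩
    exact ⟨T.smul_mem c hQ1, by simp [LinearMap.smul_apply, hQ2]⟩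

/-- A linear map on `ℝ²` is determined by its values at `e1` and `e2`. -/
lemma linearMap_ext_e1_e2 {M : Type*} [AddCommMonoid M] [Module ℝ M]
    {f g : (Fin 2 → ℝ) →ₗ[ℝ] M} (h1 : f e1 = g e1) (h2 : f e2 = g e2) : f = g := by
  refine LinearMap.pi_ext' fun i => LinearMap.ext_ring ?_
  fin_cases i
  · exact h1
  · exact h2

/-- Linear coordinates on `W⁽¹⁾`: seven components of `F e1 e1`, `F e1 e2` and `F e2 e2`. -/
noncomputable def prolongCoord : prolong W →ₗ[ℝ] (Fin 7 → ℝ) where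
  toFun F := ![F.1 e1 e1 1, F.1 e1 e1 3, F.1 e1 e2 2, F.1 e1 e1 2, F.1 e1 e1 4,
    F.1 e2 e2 1, F.1 e2 e2 2]
  map_add' F G := by
    funext i; fin_cases i <;> rfl
  map_smul' c F := by
    funext i; fin_cases i <;> rfl

/-- The symmetric bilinear map `ℝ² × ℝ² → ℝ⁵` taking the values `A`, `B`, `C` at
`(e1, e1)`, `(e1, e2)` and `(e2, e2)`. -/
noncomputable def symmBilin (A B C : Fin 5 → ℝ) :
    (Fin 2 → ℝ) →ₗ[ℝ] ((Fin 2 → ℝ) →ₗ[ℝ] (Fin 5 → ℝ)) :=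
  LinearMap.mk₂ ℝ
    (fun v w => (v 0 * w 0) • A + (v 0 * w 1 + v 1 * w 0) • B + (v 1 * w 1) • C)
    (fun _ _ _ => by simp only [Pi.add_apply]; module)
    (fun _ _ _ => by simp only [Pi.smul_apply, smul_eq_mul]; module)
    (fun _ _ _ => by simp only [Pi.add_apply]; module)
    (fun _ _ _ => by simp only [Pi.smul_apply, smul_eq_mul]; module)

lemma symmBilin_apply (A B C : Fin 5 → ℝ) (v w : Fin 2 → ℝ) :
    symmBilin A B C v w =
      (v 0 * w 0) • A + (v 0 * w 1 + v 1 * w 0) • B + (v 1 * w 1) • C := rfl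

lemma symmBilin_mem_prolong (c : Fin 7 → ℝ) :
    symmBilin ![-3 * c 0, c 0, c 3, c 1, c 4] ![0, 0, c 2, c 4, c 3]
      ![3 * c 5, c 5, c 6, c 3, c 2] ∈ prolong W := by
  refine ⟨fun v => ⟨2 * c 0 * v 0, 2 * c 5 * v 1, c 1 * v 0 + c 4 * v 1,
    c 2 * v 0 + c 6 * v 1, c 3 * v 0 + c 2 * v 1, c 4 * v 0 + c 3 * v 1, ?_, ?_⟩, ?_⟩
  · rw [symmBilin_apply]
    funext i; fin_cases i <;> simp [e1] <;> ring
  · rw [symmBilin_apply]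
    funext i; fin_cases i <;> simp [e2] <;> ring
  · simp [symmBilin_apply, e1, e2]

lemma prolongCoord_surjective : Function.Surjective prolongCoord := fun c =>
  ⟨⟨_, symmBilin_mem_prolong c⟩, by
    funext i; fin_cases i <;> simp [prolongCoord, symmBilin_apply, e1, e2]⟩

lemma prolongCoord_injective : Function.Injective prolongCoord := by
  refine (injective_iff_map_eq_zero prolongCoord).2 ?_
  rintro ⟨F, hF, hsymm⟩ h0
  obtain ⟨q1, q2, p1, p2, r1, r2, h11, h12⟩ := hF e1
  obtain ⟨q1', q2', p1', p2', r1', r2', h21, h22⟩ := hF e2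
  have hc (i : Fin 7) := congrFun h0 i
  have hs (i : Fin 5) := congrFun (h12.symm.trans (hsymm.trans h21)) i
  simp [prolongCoord, Fin.forall_fin_succ, h11, h12, h22] at hc
  simp [Fin.forall_fin_succ] at hs
  obtain ⟨hq1, hp1, hp2, hr1, hr2, hq2', hp2'⟩ := hc
  obtain ⟨hs0, hs1, hs2, hs3, hs4⟩ := hs
  have hq2 : q2 = 0 := by linarith
  have hq1' : q1' = 0 := by linarith
  subst_vars
  refine Subtype.ext (linearMap_ext_e1_e2 (linearMap_ext_e1_e2 ?_ ?_)
    (linearMap_ext_e1_e2 ?_ ?_))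
  · rw [h11]; funext i; fin_cases i <;> simp
  · rw [h12]; funext i; fin_cases i <;> simp
  · rw [h21]; funext i; fin_cases i <;> simp
  · rw [h22]; funext i; fin_cases i <;> simp

/-- The first prolongation `W⁽¹⁾` of the Fubini–Cartan tableau `W` has
dimension 7. -/
theorem finrank_prolong_fubiniCartan : finrank ℝ (prolong W) = 7 := by
  rw [(LinearEquiv.ofBijective prolongCoord
    ⟨prolongCoord_injective, prolongCoord_surjective⟩).finrank_eq, finrank_fin_fun]
end

section
/- The linear map ρ̃ : Hom(ℝ², W) → ℝ⁵ defined by ρ̃(F) = F(e1)(e2) − F(e2)(e1) is surjective, where W is the Fubini–Cartan tableau. (Equivalently, the map ρ : Hom(a, W) → b ⊗ Λ²(a*) is surjective, so that τ_Q ∈ Im ρ for every Q ∈ W.) -/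
set_option synthInstance.maxHeartbeats 1000000
set_option maxHeartbeats 1000000

open Module

/-- A linear map out of `ℝ²` may take arbitrary prescribed values on `e1` and `e2`, and all its
values are linear combinations of these two. -/
theorem exists_linearMap_apply_e1_e2 {M : Type*} [AddCommMonoid M] [Module ℝ M] (x y : M) :
    ∃ f : (Fin 2 → ℝ) →ₗ[ℝ] M,
      f e1 = x ∧ f e2 = y ∧ ∀ v, f v = v 0 • x + v 1 • y := by
  refine ⟨(LinearMap.proj 0).smulRight x + (LinearMap.proj 1).smulRight y, ?_, ?_, fun v => ?_⟩ <;>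
    simp [e1, e2]

/-- The linear map `ρ̃ : Hom(ℝ², W) → ℝ⁵`, `F ↦ F(e1)(e2) − F(e2)(e1)`, is
surjective, where `W` is the Fubini–Cartan tableau and `Hom(ℝ², W)` is
realized as the space of linear maps `ℝ² → Hom(ℝ², ℝ⁵)` all of whose values
lie in `W`.  (Equivalently, the map `ρ : Hom(a, W) → b ⊗ Λ²(a*)` is
surjective, so that `τ_Q ∈ Im ρ` for every `Q ∈ W`.) -/
theorem rhoTilde_surjective :
    ∀ y : Fin 5 → ℝ,
      ∃ F : (Fin 2 → ℝ) →ₗ[ℝ] ((Fin 2 → ℝ) →ₗ[ℝ] (Fin 5 → ℝ)),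
        (∀ v, F v ∈ W) ∧ F e1 e2 - F e2 e1 = y := by
  intro y
  obtain ⟨A, hA1, hA2, -⟩ := exists_linearMap_apply_e1_e2
    ![-(3/2) * 0, (1/2) * 0, y 4, 0, 0]
    ![(3/2) * (y 0 / 3 + y 1), (1/2) * (y 0 / 3 + y 1), y 2, 0, y 4]
  obtain ⟨B, hB1, hB2, -⟩ := exists_linearMap_apply_e1_e2
    ![-(3/2) * (y 0 / 3 - y 1), (1/2) * (y 0 / 3 - y 1), 0, -y 3, 0]
    ![(3/2) * 0, (1/2) * 0, 0, 0, 0]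
  have hA : A ∈ W := ⟨_, _, _, _, _, _, hA1, hA2⟩
  have hB : B ∈ W := ⟨_, _, _, _, _, _, hB1, hB2⟩
  obtain ⟨F, hF1, hF2, hF⟩ := exists_linearMap_apply_e1_e2 A B
  refine ⟨F, fun v => ?_, ?_⟩
  · rw [hF]
    exact W.add_mem (W.smul_mem _ hA) (W.smul_mem _ hB)
  · rw [hF1, hF2, hA2, hB1]
    funext i
    fin_cases i <;> simp <;> ring
end

section
/- Let W_GR = {Q(q1,q2,p1,p2,r1,r2) ∈ W : r2 = 0} be the Godeaux–Rozet tableau, a 5-dimensional subspace of the Fubini–Cartan tableau W. Then its first prolongation W_GR^(1) has dimension 5, and for all real λ, μ with λ·μ ≠ 0 the subspace {Q ∈ W_GR : Q(λ·e1 + μ·e2) = 0} is zero. Hence W_GR is involutive with characters s'_1 = 5 and s'_2 = 0. -/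
set_option synthInstance.maxHeartbeats 1000000
set_option maxHeartbeats 1000000

open Module

/-- The Godeaux–Rozet tableau
`W_GR = {Q(q1,q2,p1,p2,r1,r2) ∈ W : r2 = 0}`. -/
noncomputable def WGR : Submodule ℝ ((Fin 2 → ℝ) →ₗ[ℝ] (Fin 5 → ℝ)) where
  carrier := {Q | ∃ q1 q2 p1 p2 r1 : ℝ, memW Q q1 q2 p1 p2 r1 0}
  add_mem' := by
    rintro Q Q' ⟨a1, a2, a3, a4, a5, h1, h2⟩ ⟨b1, b2, b3, b4, b5, k1, k2⟩
    refine ⟨a1 + b1, a2 + b2, a3 + b3, a4 + b4, a5 + b5, ?_, ?_⟩ <;>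
      · simp only [LinearMap.add_apply, h1, h2, k1, k2]
        funext i; fin_cases i <;> simp <;> ring
  zero_mem' := by
    refine ⟨0, 0, 0, 0, 0, ?_, ?_⟩ <;>
      · funext i; fin_cases i <;> simp
  smul_mem' := by
    rintro c Q ⟨a1, a2, a3, a4, a5, h1, h2⟩
    refine ⟨c * a1, c * a2, c * a3, c * a4, c * a5, ?_, ?_⟩ <;>
      · simp only [LinearMap.smul_apply, h1, h2]
        funext i; fin_cases i <;> simp <;> ring

/-- The linear map `ℝ² → M` sending `e1` to `u` and `e2` to `v`. -/
noncomputable def homOfPair {M : Type*} [AddCommMonoid M] [Module ℝ M] (u v : M) :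
    (Fin 2 → ℝ) →ₗ[ℝ] M :=
  (LinearMap.proj 0).smulRight u + (LinearMap.proj 1).smulRight v

section homOfPair

variable {M : Type*} [AddCommMonoid M] [Module ℝ M]

@[simp]
lemma homOfPair_e1 (u v : M) : homOfPair u v e1 = u := by
  simp [homOfPair, e1]

@[simp]
lemma homOfPair_e2 (u v : M) : homOfPair u v e2 = v := by
  simp [homOfPair, e2]

lemma homOfPair_apply (u v : M) (x : Fin 2 → ℝ) : homOfPair u v x = x 0 • u + x 1 • v := by
  simp [homOfPair]

lemma hom_ext_e1_e2 {f g : (Fin 2 → ℝ) →ₗ[ℝ] M} (h1 : f e1 = g e1) (h2 : f e2 = g e2) :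
    f = g := by
  refine LinearMap.pi_ext' fun i => LinearMap.ext_ring ?_
  fin_cases i
  · exact h1
  · exact h2

end homOfPair

lemma homOfPair_mem_prolong {T : Submodule ℝ ((Fin 2 → ℝ) →ₗ[ℝ] (Fin 5 → ℝ))}
    {A B : (Fin 2 → ℝ) →ₗ[ℝ] (Fin 5 → ℝ)} (hA : A ∈ T) (hB : B ∈ T) (h : A e2 = B e1) :
    homOfPair A B ∈ prolong T := by
  refine ⟨fun v => ?_, by simpa using h⟩
  rw [homOfPair_apply]
  exact T.add_mem (T.smul_mem _ hA) (T.smul_mem _ hB)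

lemma WGR_le_W : WGR ≤ W := by
  rintro Q ⟨q1, q2, p1, p2, r1, h⟩
  exact ⟨q1, q2, p1, p2, r1, 0, h⟩

/-- The parameters `(q1, q2, p1, p2, r1)` of an element of `WGR`. -/
noncomputable def WGRCoords : WGR →ₗ[ℝ] (Fin 5 → ℝ) where
  toFun Q := ![2 * Q.1 e1 1, 2 * Q.1 e2 1, Q.1 e1 3, Q.1 e2 2, Q.1 e1 2]
  map_add' Q R := by
    funext i; fin_cases i <;> simp [mul_add]
  map_smul' c Q := by
    funext i; fin_cases i <;> simp [mul_left_comm]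

lemma WGRCoords_bijective : Function.Bijective WGRCoords := by
  constructor
  · rw [← LinearMap.ker_eq_bot, LinearMap.ker_eq_bot']
    rintro ⟨Q, q1, q2, p1, p2, r1, h1, h2⟩ h
    simp only [WGRCoords, LinearMap.coe_mk, AddHom.coe_mk, h1, h2] at h
    simp at h
    obtain ⟨rfl, rfl, rfl, rfl, rfl⟩ := h
    refine Subtype.ext (hom_ext_e1_e2 ?_ ?_)
    · simp [h1]
    · simp [h2]
  · intro x
    refine ⟨⟨homOfPair ![-(3/2) * x 0, (1/2) * x 0, x 4, x 2, 0]
      ![(3/2) * x 1, (1/2) * x 1, x 3, 0, x 4],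
      x 0, x 1, x 2, x 3, x 4, homOfPair_e1 _ _, homOfPair_e2 _ _⟩, ?_⟩
    funext i; fin_cases i <;> simp [WGRCoords]

lemma finrank_WGR : finrank ℝ WGR = 5 := by
  simpa using (LinearEquiv.ofBijective WGRCoords WGRCoords_bijective).finrank_eq

/-- The free parameters `(q1, p1, p2)` of `F e1` and `(q2, p2)` of `F e2` for an element `F` of the
first prolongation of `WGR`. -/
noncomputable def prolongWGRCoords : prolong WGR →ₗ[ℝ] (Fin 5 → ℝ) where
  toFun F := ![2 * F.1 e1 e1 1, F.1 e1 e1 3, F.1 e1 e2 2, 2 * F.1 e2 e2 1, F.1 e2 e2 2]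
  map_add' F G := by
    funext i; fin_cases i <;> simp [mul_add]
  map_smul' c F := by
    funext i; fin_cases i <;> simp [mul_left_comm]

lemma prolongWGRCoords_bijective : Function.Bijective prolongWGRCoords := by
  constructor
  · rw [← LinearMap.ker_eq_bot, LinearMap.ker_eq_bot']
    rintro ⟨F, hF, hsymm⟩ h
    obtain ⟨q1, q2, p1, p2, r1, h1, h2⟩ := hF e1
    obtain ⟨q1', q2', p1', p2', r1', h1', h2'⟩ := hF e2
    simp only [prolongWGRCoords, LinearMap.coe_mk, AddHom.coe_mk, h1, h2, h2'] at h
    simp at h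
    obtain ⟨rfl, rfl, rfl, rfl, rfl⟩ := h
    rw [h2, h1'] at hsymm
    simp at hsymm
    obtain ⟨ha, hb, hc, hd, he⟩ := hsymm
    obtain rfl : q2 = 0 := by linarith
    obtain rfl : q1' = 0 := by linarith
    subst hc hd he
    refine Subtype.ext (hom_ext_e1_e2 (hom_ext_e1_e2 ?_ ?_) (hom_ext_e1_e2 ?_ ?_))
    · simp [h1]
    · simp [h2]
    · simp [h1']
    · simp [h2']
  · intro x
    have hA : homOfPair ![-(3/2) * x 0, (1/2) * x 0, 0, x 1, 0]
        ![(3/2) * 0, (1/2) * 0, x 2, 0, 0] ∈ WGR :=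
      ⟨x 0, 0, x 1, x 2, 0, homOfPair_e1 _ _, homOfPair_e2 _ _⟩
    have hB : homOfPair ![-(3/2) * 0, (1/2) * 0, x 2, 0, 0]
        ![(3/2) * x 3, (1/2) * x 3, x 4, 0, x 2] ∈ WGR :=
      ⟨0, x 3, 0, x 4, x 2, homOfPair_e1 _ _, homOfPair_e2 _ _⟩
    refine ⟨⟨_, homOfPair_mem_prolong hA hB (by simp)⟩, ?_⟩
    funext i; fin_cases i <;> simp [prolongWGRCoords]

lemma finrank_prolong_WGR : finrank ℝ (prolong WGR) = 5 := by
  simpa using (LinearEquiv.ofBijective prolongWGRCoords prolongWGRCoords_bijective).finrank_eq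

lemma vanishAt_WGR_eq_bot {lam mu : ℝ} (h : lam * mu ≠ 0) :
    vanishAt WGR (lam • e1 + mu • e2) = ⊥ := by
  obtain ⟨hl, hm⟩ := mul_ne_zero_iff.mp h
  rw [Submodule.eq_bot_iff]
  rintro Q ⟨⟨q1, q2, p1, p2, r1, h1, h2⟩, hQ⟩
  rw [map_add, map_smul, map_smul, h1, h2] at hQ
  simp [hl, hm] at hQ
  obtain ⟨ha, hb, hc, rfl, rfl⟩ := hQ
  obtain rfl : q1 = 0 := (mul_eq_zero_iff_left hl).mp (by linarith)
  obtain rfl : q2 = 0 := (mul_eq_zero_iff_left hm).mp (by linarith)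
  obtain rfl : p2 = 0 := by simpa [hm] using hc
  refine hom_ext_e1_e2 ?_ ?_
  · simp [h1]
  · simp [h2]

/-- The Godeaux–Rozet tableau `W_GR = {Q(q1,q2,p1,p2,r1,r2) ∈ W : r2 = 0}` is
a 5-dimensional subspace of the Fubini–Cartan tableau `W`, its first
prolongation `W_GR⁽¹⁾` has dimension 5, and for all real `λ, μ` with
`λ·μ ≠ 0` the subspace `{Q ∈ W_GR : Q(λ·e1 + μ·e2) = 0}` is zero.  Hence
`W_GR` is involutive with characters `s'_1 = 5` and `s'_2 = 0`:
`dim W_GR⁽¹⁾ = 5 = s'_1 + 2·s'_2`. -/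
theorem godeauxRozet_involutive :
    WGR ≤ W ∧
    finrank ℝ WGR = 5 ∧
    finrank ℝ (prolong WGR) = 5 ∧
    (∀ lam mu : ℝ, lam * mu ≠ 0 → vanishAt WGR (lam • e1 + mu • e2) = ⊥) ∧
    finrank ℝ (prolong WGR) = 5 + 2 * 0 := by
  exact ⟨WGR_le_W, finrank_WGR, finrank_prolong_WGR, fun _ _ => vanishAt_WGR_eq_bot,
    finrank_prolong_WGR⟩
end

section
/- Let W_D = {Q(q1,q2,p1,p2,r1,r2) ∈ W : r1 = r2 = 0} be the Demoulin tableau, a 4-dimensional subspace of the Fubini–Cartan tableau W. Then its first prolongation W_D^(1) has dimension 4, and for all real λ, μ with λ·μ ≠ 0 the subspace {Q ∈ W_D : Q(λ·e1 + μ·e2) = 0} is zero. Hence W_D is involutive with characters s'_1 = 4 and s'_2 = 0. -/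
set_option synthInstance.maxHeartbeats 1000000
set_option maxHeartbeats 1000000

open Module

/-- The Demoulin tableau
`W_D = {Q(q1,q2,p1,p2,r1,r2) ∈ W : r1 = r2 = 0}`. -/
noncomputable def WD : Submodule ℝ ((Fin 2 → ℝ) →ₗ[ℝ] (Fin 5 → ℝ)) where
  carrier := {Q | ∃ q1 q2 p1 p2 : ℝ, memW Q q1 q2 p1 p2 0 0}
  add_mem' := by
    rintro Q Q' ⟨a1, a2, a3, a4, h1, h2⟩ ⟨b1, b2, b3, b4, k1, k2⟩
    refine ⟨a1 + b1, a2 + b2, a3 + b3, a4 + b4, ?_, ?_⟩ <;>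
      · simp only [LinearMap.add_apply, h1, h2, k1, k2]
        funext i; fin_cases i <;> simp <;> ring
  zero_mem' := by
    refine ⟨0, 0, 0, 0, ?_, ?_⟩ <;>
      · funext i; fin_cases i <;> simp
  smul_mem' := by
    rintro c Q ⟨a1, a2, a3, a4, h1, h2⟩
    refine ⟨c * a1, c * a2, c * a3, c * a4, ?_, ?_⟩ <;>
      · simp only [LinearMap.smul_apply, h1, h2]
        funext i; fin_cases i <;> simp <;> ring

/-- The linear map on `ℝ²` with values `u` and `v` on the standard basis. -/
noncomputable def homOfBasisValues {M : Type*} [AddCommMonoid M] [Module ℝ M] (u v : M) :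
    (Fin 2 → ℝ) →ₗ[ℝ] M :=
  (LinearMap.proj 0 : (Fin 2 → ℝ) →ₗ[ℝ] ℝ).smulRight u +
    (LinearMap.proj 1 : (Fin 2 → ℝ) →ₗ[ℝ] ℝ).smulRight v

theorem homOfBasisValues_apply {M : Type*} [AddCommMonoid M] [Module ℝ M] (u v : M)
    (x : Fin 2 → ℝ) : homOfBasisValues u v x = x 0 • u + x 1 • v := rfl

theorem homOfBasisValues_e1 {M : Type*} [AddCommMonoid M] [Module ℝ M] (u v : M) :
    homOfBasisValues u v e1 = u := by
  simp [homOfBasisValues_apply, e1]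

theorem homOfBasisValues_e2 {M : Type*} [AddCommMonoid M] [Module ℝ M] (u v : M) :
    homOfBasisValues u v e2 = v := by
  simp [homOfBasisValues_apply, e2]

theorem hom_ext_basis {M : Type*} [AddCommMonoid M] [Module ℝ M]
    {F G : (Fin 2 → ℝ) →ₗ[ℝ] M} (h1 : F e1 = G e1) (h2 : F e2 = G e2) : F = G := by
  refine LinearMap.pi_ext' fun i => LinearMap.ext_ring ?_
  fin_cases i
  · exact h1
  · exact h2

/-- The element of the Demoulin tableau with parameters `q1, q2, p1, p2`. -/
noncomputable def demoulinHom (q1 q2 p1 p2 : ℝ) : (Fin 2 → ℝ) →ₗ[ℝ] (Fin 5 → ℝ) :=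
  homOfBasisValues ![-(3/2) * q1, (1/2) * q1, 0, p1, 0] ![(3/2) * q2, (1/2) * q2, p2, 0, 0]

theorem demoulinHom_e1 (q1 q2 p1 p2 : ℝ) :
    demoulinHom q1 q2 p1 p2 e1 = ![-(3/2) * q1, (1/2) * q1, 0, p1, 0] :=
  homOfBasisValues_e1 _ _

theorem demoulinHom_e2 (q1 q2 p1 p2 : ℝ) :
    demoulinHom q1 q2 p1 p2 e2 = ![(3/2) * q2, (1/2) * q2, p2, 0, 0] :=
  homOfBasisValues_e2 _ _

theorem demoulinHom_mem (q1 q2 p1 p2 : ℝ) : demoulinHom q1 q2 p1 p2 ∈ WD :=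
  ⟨q1, q2, p1, p2, demoulinHom_e1 .., demoulinHom_e2 ..⟩

theorem exists_eq_demoulinHom {Q : (Fin 2 → ℝ) →ₗ[ℝ] (Fin 5 → ℝ)} (hQ : Q ∈ WD) :
    ∃ q1 q2 p1 p2, Q = demoulinHom q1 q2 p1 p2 := by
  obtain ⟨q1, q2, p1, p2, h1, h2⟩ := hQ
  exact ⟨q1, q2, p1, p2, hom_ext_basis (h1.trans (demoulinHom_e1 ..).symm)
    (h2.trans (demoulinHom_e2 ..).symm)⟩

/-- The coordinates `(q1, q2, p1, p2)`, up to scale, on the Demoulin tableau. -/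
noncomputable def demoulinCoords : WD →ₗ[ℝ] (Fin 4 → ℝ) where
  toFun Q := ![Q.1 e1 1, Q.1 e2 1, Q.1 e1 3, Q.1 e2 2]
  map_add' Q R := by
    funext i; fin_cases i <;> simp
  map_smul' c Q := by
    funext i; fin_cases i <;> simp

theorem demoulinCoords_bijective : Function.Bijective demoulinCoords := by
  constructor
  · rintro ⟨Q, hQ⟩ ⟨R, hR⟩ h
    obtain ⟨a1, a2, b1, b2, rfl⟩ := exists_eq_demoulinHom hQ
    obtain ⟨c1, c2, d1, d2, rfl⟩ := exists_eq_demoulinHom hR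
    simp [demoulinCoords, demoulinHom_e1, demoulinHom_e2] at h
    simp [h]
  · intro x
    refine ⟨⟨demoulinHom (2 * x 0) (2 * x 1) (x 2) (x 3), demoulinHom_mem ..⟩, ?_⟩
    funext i
    fin_cases i <;> simp [demoulinCoords, demoulinHom_e1, demoulinHom_e2]

theorem finrank_WD : finrank ℝ WD = 4 := by
  simpa using (LinearEquiv.ofBijective demoulinCoords demoulinCoords_bijective).finrank_eq

/-- The element of the first prolongation of the Demoulin tableau with the given parameters. -/
noncomputable def demoulinProlong (q1 p1 q2 p2 : ℝ) :
    (Fin 2 → ℝ) →ₗ[ℝ] ((Fin 2 → ℝ) →ₗ[ℝ] (Fin 5 → ℝ)) :=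
  homOfBasisValues (demoulinHom q1 0 p1 0) (demoulinHom 0 q2 0 p2)

theorem demoulinProlong_e1 (q1 p1 q2 p2 : ℝ) :
    demoulinProlong q1 p1 q2 p2 e1 = demoulinHom q1 0 p1 0 :=
  homOfBasisValues_e1 _ _

theorem demoulinProlong_e2 (q1 p1 q2 p2 : ℝ) :
    demoulinProlong q1 p1 q2 p2 e2 = demoulinHom 0 q2 0 p2 :=
  homOfBasisValues_e2 _ _

theorem demoulinProlong_mem (q1 p1 q2 p2 : ℝ) :
    demoulinProlong q1 p1 q2 p2 ∈ prolong WD := by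
  refine ⟨fun v => ?_, ?_⟩
  · exact WD.add_mem (WD.smul_mem _ (demoulinHom_mem ..)) (WD.smul_mem _ (demoulinHom_mem ..))
  · rw [demoulinProlong_e1, demoulinProlong_e2, demoulinHom_e1, demoulinHom_e2]
    simp

theorem exists_eq_demoulinProlong
    {F : (Fin 2 → ℝ) →ₗ[ℝ] ((Fin 2 → ℝ) →ₗ[ℝ] (Fin 5 → ℝ))} (hF : F ∈ prolong WD) :
    ∃ q1 p1 q2 p2, F = demoulinProlong q1 p1 q2 p2 := by
  obtain ⟨hmem, hsymm⟩ := hF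
  obtain ⟨a1, a2, b1, b2, h1⟩ := exists_eq_demoulinHom (hmem e1)
  obtain ⟨c1, c2, d1, d2, h2⟩ := exists_eq_demoulinHom (hmem e2)
  rw [h1, h2, demoulinHom_e1, demoulinHom_e2] at hsymm
  have k0 : 3 / 2 * a2 = -(3 / 2) * c1 := congrFun hsymm 0
  have k1 : 1 / 2 * a2 = 1 / 2 * c1 := congrFun hsymm 1
  obtain rfl : b2 = 0 := congrFun hsymm 2
  obtain rfl : 0 = d1 := congrFun hsymm 3
  obtain rfl : a2 = 0 := by linarith
  obtain rfl : c1 = 0 := by linarith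
  exact ⟨a1, b1, c2, d2, hom_ext_basis (h1.trans (demoulinProlong_e1 ..).symm)
    (h2.trans (demoulinProlong_e2 ..).symm)⟩

/-- Coordinates on the first prolongation of the Demoulin tableau. -/
noncomputable def demoulinProlongCoords : prolong WD →ₗ[ℝ] (Fin 4 → ℝ) where
  toFun F := ![F.1 e1 e1 1, F.1 e1 e1 3, F.1 e2 e2 1, F.1 e2 e2 2]
  map_add' F G := by
    funext i; fin_cases i <;> simp
  map_smul' c F := by
    funext i; fin_cases i <;> simp

theorem demoulinProlongCoords_bijective : Function.Bijective demoulinProlongCoords := by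
  constructor
  · rintro ⟨F, hF⟩ ⟨G, hG⟩ h
    obtain ⟨a1, a2, b1, b2, rfl⟩ := exists_eq_demoulinProlong hF
    obtain ⟨c1, c2, d1, d2, rfl⟩ := exists_eq_demoulinProlong hG
    simp [demoulinProlongCoords, demoulinProlong_e1, demoulinProlong_e2, demoulinHom_e1,
      demoulinHom_e2] at h
    simp [h]
  · intro x
    refine ⟨⟨demoulinProlong (2 * x 0) (x 1) (2 * x 2) (x 3), demoulinProlong_mem ..⟩, ?_⟩
    funext i
    fin_cases i <;> simp [demoulinProlongCoords, demoulinProlong_e1, demoulinProlong_e2,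
      demoulinHom_e1, demoulinHom_e2]

theorem finrank_prolong_WD : finrank ℝ (prolong WD) = 4 := by
  simpa using
    (LinearEquiv.ofBijective demoulinProlongCoords demoulinProlongCoords_bijective).finrank_eq

theorem vanishAt_WD_eq_bot {lam mu : ℝ} (h : lam * mu ≠ 0) :
    vanishAt WD (lam • e1 + mu • e2) = ⊥ := by
  obtain ⟨hl, hm⟩ := mul_ne_zero_iff.mp h
  rw [eq_bot_iff]
  rintro Q ⟨hQ, hv⟩
  obtain ⟨q1, q2, p1, p2, rfl⟩ := exists_eq_demoulinHom hQ
  rw [map_add, map_smul, map_smul, demoulinHom_e1, demoulinHom_e2] at hv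
  have k0 : lam * (-(3 / 2) * q1) + mu * (3 / 2 * q2) = 0 := congrFun hv 0
  have k1 : lam * (1 / 2 * q1) + mu * (1 / 2 * q2) = 0 := congrFun hv 1
  have k2 : lam * 0 + mu * p2 = 0 := congrFun hv 2
  have k3 : lam * p1 + mu * 0 = 0 := congrFun hv 3
  obtain rfl : q1 = 0 := (mul_eq_zero.mp (by linarith : lam * q1 = 0)).resolve_left hl
  obtain rfl : q2 = 0 := (mul_eq_zero.mp (by linarith : mu * q2 = 0)).resolve_left hm
  obtain rfl : p1 = 0 := (mul_eq_zero.mp (by linarith : lam * p1 = 0)).resolve_left hl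
  obtain rfl : p2 = 0 := (mul_eq_zero.mp (by linarith : mu * p2 = 0)).resolve_left hm
  refine (Submodule.mem_bot ℝ).mpr (hom_ext_basis ?_ ?_)
  · simp [demoulinHom_e1]
  · simp [demoulinHom_e2]

theorem WD_le_W : WD ≤ W := by
  rintro Q ⟨q1, q2, p1, p2, h⟩
  exact ⟨q1, q2, p1, p2, 0, 0, h⟩

/-- The Demoulin tableau `W_D = {Q(q1,q2,p1,p2,r1,r2) ∈ W : r1 = r2 = 0}` is
a 4-dimensional subspace of the Fubini–Cartan tableau `W`, its first
prolongation `W_D⁽¹⁾` has dimension 4, and for all real `λ, μ` with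
`λ·μ ≠ 0` the subspace `{Q ∈ W_D : Q(λ·e1 + μ·e2) = 0}` is zero.  Hence
`W_D` is involutive with characters `s'_1 = 4` and `s'_2 = 0`:
`dim W_D⁽¹⁾ = 4 = s'_1 + 2·s'_2`. -/
theorem demoulin_involutive :
    WD ≤ W ∧
    finrank ℝ WD = 4 ∧
    finrank ℝ (prolong WD) = 4 ∧
    (∀ lam mu : ℝ, lam * mu ≠ 0 → vanishAt WD (lam • e1 + mu • e2) = ⊥) ∧
    finrank ℝ (prolong WD) = 4 + 2 * 0 := by
  exact ⟨WD_le_W, finrank_WD, finrank_prolong_WD, fun _ _ => vanishAt_WD_eq_bot,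
    finrank_prolong_WD⟩
end
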